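/- arXiv:2604.14669 — 2 statements merged into one kernel-verified Lean document; each statement's English description precedes it below -/
import Mathlib

section
/- Let T be the ZO-GDM covariance operator on (𝕊²)^d. Then T preserves the cone (𝕊²₊)^d, i.e. if every W_i is positive semidefinite then so is every (T(W))_i. Moreover, T has an eigenvalue equal to its spectral radius ρ(T), with an associated eigenvector W* = (W*_1, …, W*_d) ∈ (𝕊²₊)^d \ {0} satisfying T(W*) = ρ(T) W*, and this data satisfies ρ(T) ≥ η² Σ_{i=1}^d λ_i² > 0 and Σ_{i=1}^d (W*_i)_{11} > 0. -/
open Matrix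

noncomputable instance : NormedAddCommGroup (Matrix (Fin 2) (Fin 2) ℝ) :=
  inferInstanceAs (NormedAddCommGroup (Fin 2 → Fin 2 → ℝ))

noncomputable instance : NormedSpace ℝ (Matrix (Fin 2) (Fin 2) ℝ) :=
  inferInstanceAs (NormedSpace ℝ (Fin 2 → Fin 2 → ℝ))

/-- The space `𝕊²` of 2×2 real symmetric matrices, as a submodule of the 2×2 matrices. -/
def Sym2Mat : Submodule ℝ (Matrix (Fin 2) (Fin 2) ℝ) where
  carrier := {X | X.IsSymm}
  add_mem' := fun hA hB => hA.add hB
  zero_mem' := Matrix.isSymm_zero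
  smul_mem' := fun c _ hX => hX.smul c

/-- The matrix `A = [[1−ηλ, −β],[ηλ, β]]`. -/
def Amat (η β l : ℝ) : Matrix (Fin 2) (Fin 2) ℝ := !![1 - η * l, -β; η * l, β]

/-- The matrix `Q = [[1,−1],[−1,1]]`. -/
def Qmat : Matrix (Fin 2) (Fin 2) ℝ := !![1, -1; -1, 1]

open Filter Topology in
lemma kr_aux_pow_le {V : Type*} [NormedAddCommGroup V] [NormedSpace ℝ V]
    (T : V →L[ℝ] V) (ρ : ℝ)
    (hρ : Tendsto (fun n : ℕ => ‖T ^ n‖ ^ ((n : ℝ)⁻¹)) atTop (𝓝 ρ)) (hρ0 : 0 ≤ ρ)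
    (n : ℕ) (hn : 0 < n) : ρ ^ n ≤ ‖T ^ n‖ := by
  have h1 : Tendsto (fun k : ℕ => n * k) atTop atTop :=
    tendsto_id.const_mul_atTop' hn
  have h2 := hρ.comp h1
  have h3 : ρ ≤ ‖T ^ n‖ ^ ((n : ℝ)⁻¹) := by
    refine le_of_tendsto h2 ?_
    filter_upwards [eventually_gt_atTop 0] with k hk
    simp only [Function.comp]
    have h4 : ‖T ^ (n * k)‖ ≤ ‖T ^ n‖ ^ k := by
      rw [pow_mul]; exact norm_pow_le' _ hk
    calc ‖T ^ (n * k)‖ ^ (((n * k : ℕ) : ℝ)⁻¹) ≤ (‖T ^ n‖ ^ k) ^ (((n * k : ℕ) : ℝ)⁻¹) :=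
          Real.rpow_le_rpow (norm_nonneg _) h4 (by positivity)
      _ = ‖T ^ n‖ ^ ((n : ℝ)⁻¹) := by
          rw [← Real.rpow_natCast, ← Real.rpow_mul (norm_nonneg _)]
          congr 1
          have : (k : ℝ) ≠ 0 := by positivity
          have : (n : ℝ) ≠ 0 := by positivity
          push_cast
          field_simp
  calc ρ ^ n ≤ (‖T ^ n‖ ^ ((n : ℝ)⁻¹)) ^ n := pow_le_pow_left₀ hρ0 h3 n
    _ = ‖T ^ n‖ := Real.rpow_inv_natCast_pow (norm_nonneg _) hn.ne'

open Filter Topology in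
lemma kr_abstract {V : Type*} [NormedAddCommGroup V] [NormedSpace ℝ V] [FiniteDimensional ℝ V]
    (K : Set V) (hK : IsClosed K) (hadd : ∀ x ∈ K, ∀ y ∈ K, x + y ∈ K)
    (hsmul : ∀ c : ℝ, 0 ≤ c → ∀ x ∈ K, c • x ∈ K)
    (φ : V →L[ℝ] ℝ) (hφ : ∀ x ∈ K, ‖x‖ ≤ φ x)
    (e : V) (he : ∀ x, ‖x‖ ≤ 1 → e + x ∈ K)
    (T : V →L[ℝ] V) (hTK : ∀ x ∈ K, T x ∈ K) (ρ : ℝ)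
    (hρ : Tendsto (fun n : ℕ => ‖T ^ n‖ ^ ((n : ℝ)⁻¹)) atTop (𝓝 ρ))
    (W : V) (hW : W ∈ K) (hW0 : W ≠ 0) (s : ℝ) (hs : 0 < s) (hTW : T W - s • W ∈ K) :
    s ≤ ρ ∧ ∃ x ∈ K, φ x = 1 ∧ T x = ρ • x := by
  have heK : e ∈ K := by simpa using he 0 (by simp)
  have h0K : (0 : V) ∈ K := by simpa using hsmul 0 le_rfl e heK
  have hTnK : ∀ n : ℕ, ∀ x ∈ K, (T ^ n) x ∈ K := by
    intro n
    induction n with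
    | zero => intro x hx; simpa using hx
    | succ n ih =>
      intro x hx
      rw [pow_succ]
      exact ih _ (hTK x hx)
  have hφn : ∀ x ∈ K, 0 ≤ φ x := fun x hx => (norm_nonneg x).trans (hφ x hx)
  have hφW : 0 < φ W := (norm_pos_iff.2 hW0).trans_le (hφ W hW)
  -- lower bound
  have hlow : ∀ n : ℕ, s ^ n * φ W ≤ φ ((T ^ n) W) := by
    intro n
    induction n with
    | zero => simp
    | succ n ih =>
      have h1 := hφn _ (hTnK n _ hTW)
      simp only [map_sub, map_smul, smul_eq_mul] at h1
      have h2 : (T ^ (n+1)) W = (T ^ n) (T W) := by rw [pow_succ]; rfl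
      rw [h2, pow_succ]
      nlinarith
  have hsρ : s ≤ ρ := by
    have hφ1 : 0 < ‖φ‖ := by
      rw [norm_pos_iff]; rintro rfl; simp at hφW
    have hW1 : 0 < ‖W‖ := norm_pos_iff.2 hW0
    set c := φ W / (‖φ‖ * ‖W‖) with hc
    have hcpos : 0 < c := by positivity
    have hb : ∀ n : ℕ, s ^ n * c ≤ ‖T ^ n‖ := by
      intro n
      have h1 : φ ((T ^ n) W) ≤ ‖φ‖ * (‖T ^ n‖ * ‖W‖) :=
        (le_abs_self _).trans ((φ.le_opNorm _).trans
          (mul_le_mul_of_nonneg_left ((T ^ n).le_opNorm W) (norm_nonneg _)))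
      have h2 := (hlow n).trans h1
      rw [hc, ← mul_div_assoc, div_le_iff₀ (by positivity)]
      linarith
    have hlim : Tendsto (fun n : ℕ => s * c ^ ((n : ℝ)⁻¹)) atTop (𝓝 (s * 1)) := by
      refine Tendsto.const_mul _ ?_
      have := (Real.continuousAt_const_rpow (a := c) (b := 0) hcpos.ne').tendsto.comp
        (tendsto_inv_atTop_nhds_zero_nat (𝕜 := ℝ))
      simpa [Function.comp_def] using this
    rw [mul_one] at hlim
    refine le_of_tendsto_of_tendsto hlim hρ ?_
    filter_upwards [eventually_gt_atTop 0] with n hn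
    have := Real.rpow_le_rpow (by positivity) (hb n) (z := (n : ℝ)⁻¹) (by positivity)
    rwa [Real.mul_rpow (by positivity) hcpos.le, Real.pow_rpow_inv_natCast hs.le hn.ne'] at this
  have hρ0 : 0 < ρ := hs.trans_le hsρ
  refine ⟨hsρ, ?_⟩
  -- norm bound
  have hnorm : ∀ n : ℕ, ‖T ^ n‖ ≤ φ ((T ^ n) e) := by
    intro n
    refine ContinuousLinearMap.opNorm_le_of_unit_norm (hφn _ (hTnK n e heK)) ?_
    intro x hx
    have h1 := hφ _ (hTnK n _ (he x hx.le))
    have h2 := hφ _ (hTnK n _ (he (-x) (by simp [hx])))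
    simp only [map_add, map_neg] at h1 h2
    have h3 : ‖(2 : ℝ) • (T ^ n) x‖ ≤ ‖(T ^ n) e + (T ^ n) x‖ + ‖(T ^ n) e + -(T ^ n) x‖ := by
      refine le_trans (le_of_eq ?_) (norm_sub_le _ _)
      congr 1
      rw [two_smul]; abel
    rw [norm_smul, Real.norm_ofNat] at h3
    linarith
  have hcmp : ∀ n : ℕ, 0 < n → ρ ^ n ≤ φ ((T ^ n) e) := fun n hn =>
    (kr_aux_pow_le T ρ hρ hρ0.le n hn).trans (hnorm n)
  have happrox : ∀ r : ℝ, ρ < r →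
      ∃ x ∈ K, φ x = 1 ∧ ‖r • x - T x‖ ≤ (r - ρ) * (‖e‖ * r / ρ) := by
    intro r hr
    have hr0 : 0 < r := hρ0.trans hr
    have hsumT : Summable (fun n : ℕ => (r⁻¹) ^ n • (T ^ n) e) := by
      obtain ⟨q, hq1, hq2⟩ := exists_between hr
      have hq0 := hρ0.trans hq1
      have hev : ∀ᶠ n : ℕ in atTop, ‖(r⁻¹) ^ n • (T ^ n) e‖ ≤ ‖e‖ * (q / r) ^ n := by
        filter_upwards [hρ.eventually_lt_const hq1, eventually_gt_atTop 0] with n hn hn0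
        have h1 : ‖T ^ n‖ ≤ q ^ n := by
          rw [← Real.rpow_inv_natCast_pow (norm_nonneg (T ^ n)) hn0.ne']
          exact pow_le_pow_left₀ (by positivity) hn.le n
        rw [norm_smul, norm_pow, norm_inv, Real.norm_of_nonneg hr0.le]
        calc r⁻¹ ^ n * ‖(T ^ n) e‖ ≤ r⁻¹ ^ n * (q ^ n * ‖e‖) := by
              gcongr
              exact ((T ^ n).le_opNorm e).trans (by gcongr)
          _ = _ := by rw [div_pow, inv_pow]; field_simp
      refine Summable.of_norm_bounded_eventually_nat
        (g := fun n => ‖e‖ * (q / r) ^ n) ?_ hev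
      exact (summable_geometric_of_lt_one (by positivity) ((div_lt_one hr0).2 hq2)).mul_left _
    set y := ∑' n : ℕ, (r⁻¹) ^ n • (T ^ n) e with hy
    have hpart : ∀ F : Finset ℕ, ∑ n ∈ F, (r⁻¹) ^ n • (T ^ n) e ∈ K := by
      intro F
      refine Finset.sum_induction _ (· ∈ K) (fun a b ha hb => hadd a ha b hb) h0K ?_
      intro n _
      exact hsmul _ (by positivity) _ (hTnK n e heK)
    have hyK : y ∈ K := hK.mem_of_tendsto hsumT.hasSum (Eventually.of_forall hpart)
    have hTy : T y = r • (y - e) := by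
      have h1 : y = e + ∑' n : ℕ, (r⁻¹) ^ (n+1) • (T ^ (n+1)) e := by
        rw [hy, hsumT.tsum_eq_zero_add]; simp
      have h2 : T y = ∑' n : ℕ, (r⁻¹) ^ n • (T ^ (n+1)) e := by
        rw [hy, T.map_tsum hsumT]
        refine tsum_congr fun n => ?_
        rw [map_smul, pow_succ']; rfl
      have h3 : y - e = ∑' n : ℕ, (r⁻¹) ^ (n+1) • (T ^ (n+1)) e := by
        rw [sub_eq_iff_eq_add']; exact h1
      rw [h2, h3, ← tsum_const_smul'']
      refine tsum_congr fun n => ?_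
      rw [smul_smul]; congr 1
      rw [pow_succ]; field_simp
    have hφy : ρ / (r - ρ) ≤ φ y := by
      have h1 : HasSum (fun n : ℕ => φ ((r⁻¹) ^ n • (T ^ n) e)) (φ y) := φ.hasSum hsumT.hasSum
      have h2 : HasSum (fun n : ℕ => φ ((r⁻¹) ^ (n+1) • (T ^ (n+1)) e)) (φ y - φ e) := by
        have := (hasSum_nat_add_iff' 1).2 h1
        simpa using this
      have h3 : HasSum (fun n : ℕ => (ρ / r) * (ρ / r) ^ n) ((ρ / r) * (1 - ρ / r)⁻¹) :=
        (hasSum_geometric_of_lt_one (by positivity) ((div_lt_one hr0).2 hr)).mul_left _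
      have h4 := hasSum_le (fun n => ?_) h3 h2
      · have h5 : (ρ / r) * (1 - ρ / r)⁻¹ = ρ / (r - ρ) := by
          have : r - ρ ≠ 0 := by linarith
          have : 1 - ρ / r ≠ 0 := by
            have := (div_lt_one hr0).2 hr
            linarith
          field_simp
        rw [h5] at h4
        linarith [hφn e heK]
      · rw [map_smul, smul_eq_mul, ← pow_succ', div_eq_inv_mul, mul_pow]
        exact mul_le_mul_of_nonneg_left (hcmp _ n.succ_pos) (by positivity)
    have hrρ : 0 < r - ρ := by linarith
    have hφy0 : 0 < φ y := lt_of_lt_of_le (by positivity) hφy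
    refine ⟨(φ y)⁻¹ • y, hsmul _ (by positivity) _ hyK, ?_, ?_⟩
    · rw [map_smul, smul_eq_mul, inv_mul_cancel₀ hφy0.ne']
    · have h1 : r • (φ y)⁻¹ • y - T ((φ y)⁻¹ • y) = ((φ y)⁻¹ * r) • e := by
        rw [map_smul, hTy]; module
      rw [h1, norm_smul, norm_mul, norm_inv, Real.norm_of_nonneg hφy0.le,
        Real.norm_of_nonneg hr0.le]
      have h2 : (φ y)⁻¹ ≤ (r - ρ) / ρ := by
        rw [inv_le_comm₀ hφy0 (by positivity), inv_div]; exact hφy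
      calc (φ y)⁻¹ * r * ‖e‖ ≤ (r - ρ) / ρ * r * ‖e‖ := by gcongr
        _ = _ := by ring
  have hu : ∀ k : ℕ, ρ < ρ + 1 / ((k : ℝ) + 1) := fun k => by
    have : (0 : ℝ) < 1 / ((k : ℝ) + 1) := by positivity
    linarith
  choose x hxK hx1 hxT using fun k : ℕ => happrox _ (hu k)
  have : ProperSpace V := FiniteDimensional.proper_real V
  have hball : ∀ k, x k ∈ Metric.closedBall (0 : V) 1 := fun k => by
    rw [mem_closedBall_zero_iff, ← hx1 k]; exact hφ _ (hxK k)
  obtain ⟨z, -, ψ, hψ, hz⟩ := (isCompact_closedBall (0 : V) 1).tendsto_subseq hball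
  have hr : Tendsto (fun k : ℕ => ρ + 1 / ((k : ℝ) + 1)) atTop (𝓝 ρ) := by
    simpa using (tendsto_one_div_add_atTop_nhds_zero_nat (𝕜 := ℝ)).const_add ρ
  refine ⟨z, hK.mem_of_tendsto hz (Eventually.of_forall fun k => hxK _), ?_, ?_⟩
  · have := (φ.continuous.tendsto z).comp hz
    refine tendsto_nhds_unique this ?_
    simp [Function.comp_def, hx1]
  · have hr' := hr.comp hψ.tendsto_atTop
    have h1 := (hr'.smul hz).sub ((T.continuous.tendsto z).comp hz)
    have h2 : Tendsto (fun k : ℕ => ((ρ + 1 / ((k : ℝ) + 1)) - ρ) *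
        (‖e‖ * (ρ + 1 / ((k : ℝ) + 1)) / ρ)) atTop (𝓝 ((ρ - ρ) * (‖e‖ * ρ / ρ))) :=
      (hr.sub_const ρ).mul ((hr.const_mul _).div_const _)
    rw [sub_self, zero_mul] at h2
    have h3 := squeeze_zero_norm (fun k => hxT k) h2
    have h4 := h3.comp hψ.tendsto_atTop
    have h5 := tendsto_nhds_unique h1 h4
    exact (sub_eq_zero.1 h5).symm

lemma psd2_iff (X : Matrix (Fin 2) (Fin 2) ℝ) (hX : X.IsSymm) :
    X.PosSemidef ↔ 0 ≤ X 0 0 ∧ 0 ≤ X 1 1 ∧ X 0 1 ^ 2 ≤ X 0 0 * X 1 1 := by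
  have h10 : X 1 0 = X 0 1 := hX.apply 0 1
  constructor
  · intro h
    have hd := h.det_nonneg
    rw [Matrix.det_fin_two, h10] at hd
    exact ⟨h.diag_nonneg, h.diag_nonneg, by nlinarith⟩
  · rintro ⟨h0, h1, h2⟩
    refine Matrix.PosSemidef.of_dotProduct_mulVec_nonneg ?_ ?_
    · rw [Matrix.IsHermitian, Matrix.conjTranspose_eq_transpose_of_trivial]; exact hX
    · intro v
      simp only [dotProduct, Matrix.mulVec, Fin.sum_univ_two, Pi.star_apply, star_trivial, h10]
      rcases h0.eq_or_lt with h | h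
      · have h3 : X 0 1 = 0 := by
          rw [← h] at h2; nlinarith [sq_nonneg (X 0 1)]
        rw [← h, h3]
        nlinarith [mul_nonneg h1 (sq_nonneg (v 1))]
      · have h4 : 0 ≤ X 0 0 * (v 0 * (X 0 0 * v 0 + X 0 1 * v 1) +
            v 1 * (X 0 1 * v 0 + X 1 1 * v 1)) := by
          nlinarith [sq_nonneg (X 0 0 * v 0 + X 0 1 * v 1),
            mul_nonneg (sub_nonneg.2 h2) (sq_nonneg (v 1))]
        exact nonneg_of_mul_nonneg_right h4 h

lemma sym2_norm_le (X : Sym2Mat) (c : ℝ) (hc : 0 ≤ c)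
    (h : ∀ i j, |(X : Matrix (Fin 2) (Fin 2) ℝ) i j| ≤ c) : ‖X‖ ≤ c := by
  exact (pi_norm_le_iff_of_nonneg (G := fun _ : Fin 2 => Fin 2 → ℝ) (x := X.1) hc).2
    fun i => (pi_norm_le_iff_of_nonneg (G := fun _ : Fin 2 => ℝ) (x := X.1 i) hc).2 (h i)

lemma sym2_entry_le (X : Sym2Mat) (i j : Fin 2) :
    |(X : Matrix (Fin 2) (Fin 2) ℝ) i j| ≤ ‖X‖ := by
  change _ ≤ ‖((X : Matrix (Fin 2) (Fin 2) ℝ) : Fin 2 → Fin 2 → ℝ)‖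
  exact (norm_le_pi_norm (f := ((X : Matrix (Fin 2) (Fin 2) ℝ) : Fin 2 → Fin 2 → ℝ) i) j).trans
    (norm_le_pi_norm (f := ((X : Matrix (Fin 2) (Fin 2) ℝ) : Fin 2 → Fin 2 → ℝ)) i)

/-- Entry functional. -/
def entryL (d : ℕ) (i : Fin d) (a b : Fin 2) : (Fin d → Sym2Mat) →ₗ[ℝ] ℝ where
  toFun W := (W i : Matrix (Fin 2) (Fin 2) ℝ) a b
  map_add' _ _ := rfl
  map_smul' _ _ := rfl

lemma entryL_apply (d : ℕ) (i : Fin d) (a b : Fin 2) (W : Fin d → Sym2Mat) :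
    entryL d i a b W = (W i : Matrix (Fin 2) (Fin 2) ℝ) a b := rfl

noncomputable instance : FiniteDimensional ℝ Sym2Mat :=
  inferInstanceAs (FiniteDimensional ℝ Sym2Mat)

lemma entry_continuous {d : ℕ} (i : Fin d) (a b : Fin 2) :
    Continuous (fun W : Fin d → Sym2Mat => (W i : Matrix (Fin 2) (Fin 2) ℝ) a b) :=
  (entryL d i a b).continuous_of_finiteDimensional

/-- Sum of traces. -/
noncomputable def trL (d : ℕ) : (Fin d → Sym2Mat) →L[ℝ] ℝ :=
  LinearMap.toContinuousLinearMap (∑ i, (entryL d i 0 0 + entryL d i 1 1))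

lemma trL_apply (d : ℕ) (W : Fin d → Sym2Mat) :
    trL d W = ∑ i, ((W i : Matrix (Fin 2) (Fin 2) ℝ) 0 0 + (W i : Matrix (Fin 2) (Fin 2) ℝ) 1 1) := by
  simp [trL, entryL_apply]

lemma Qmat_psd : Qmat.PosSemidef := by
  have hs : Qmat.IsSymm := by
    ext i j; fin_cases i <;> fin_cases j <;> simp [Qmat]
  rw [psd2_iff _ hs]; simp [Qmat]

/-- **Leading eigenvalue of the ZO-GDM covariance operator in the cone (Krein–Rutman).**
Let `T` be the ZO-GDM covariance operator on `(𝕊²)^d`, given blockwise by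
`(T W)_i = A_i W_i A_iᵀ + η² (λ_i² (W_i)₁₁ + Σ_j λ_j² (W_j)₁₁) Q`, and let `ρ` be its
spectral radius, i.e. the limit of `‖Tⁿ‖^{1/n}`.  Then `T` preserves the cone `(𝕊²₊)^d`,
and `T` has an eigenvector `W* ∈ (𝕊²₊)^d \ {0}` with eigenvalue `ρ`, satisfying
`ρ ≥ η² Σ_i λ_i² > 0` and `Σ_i (W*_i)₁₁ > 0`. -/
theorem zogdm_cov_operator_krein_rutman {d : ℕ} (hd : 0 < d)
    (η β : ℝ) (hη : 0 < η) (hβ : β ∈ Set.Ico (0 : ℝ) 1)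
    (lam : Fin d → ℝ) (hmono : Antitone lam) (hpos : ∀ i, 0 < lam i)
    (T : (Fin d → Sym2Mat) →L[ℝ] (Fin d → Sym2Mat))
    (hT : ∀ (W : Fin d → Sym2Mat) (i : Fin d),
      ((T W i : Matrix (Fin 2) (Fin 2) ℝ))
        = Amat η β (lam i) * (W i : Matrix (Fin 2) (Fin 2) ℝ) * (Amat η β (lam i))ᵀ
          + (η ^ 2 * (lam i ^ 2 * (W i : Matrix (Fin 2) (Fin 2) ℝ) 0 0
              + ∑ j, lam j ^ 2 * (W j : Matrix (Fin 2) (Fin 2) ℝ) 0 0)) • Qmat)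
    (ρ : ℝ)
    (hρ : Filter.Tendsto (fun n : ℕ => ‖T ^ n‖ ^ ((n : ℝ)⁻¹)) Filter.atTop (nhds ρ)) :
    (∀ W : Fin d → Sym2Mat,
      (∀ i, ((W i : Matrix (Fin 2) (Fin 2) ℝ)).PosSemidef) →
        ∀ i, ((T W i : Matrix (Fin 2) (Fin 2) ℝ)).PosSemidef) ∧
    ∃ Wstar : Fin d → Sym2Mat, Wstar ≠ 0 ∧
      (∀ i, ((Wstar i : Matrix (Fin 2) (Fin 2) ℝ)).PosSemidef) ∧
      T Wstar = ρ • Wstar ∧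
      η ^ 2 * ∑ i, lam i ^ 2 ≤ ρ ∧ 0 < η ^ 2 * ∑ i, lam i ^ 2 ∧
      0 < ∑ i, (Wstar i : Matrix (Fin 2) (Fin 2) ℝ) 0 0 := by
  have hs : 0 < η ^ 2 * ∑ i, lam i ^ 2 := by
    have : 0 < ∑ i, lam i ^ 2 :=
      Finset.sum_pos (fun i _ => pow_pos (hpos i) 2) ⟨⟨0, hd⟩, Finset.mem_univ _⟩
    positivity
  have hcone : ∀ W : Fin d → Sym2Mat,
      (∀ i, ((W i : Matrix (Fin 2) (Fin 2) ℝ)).PosSemidef) →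
        ∀ i, ((T W i : Matrix (Fin 2) (Fin 2) ℝ)).PosSemidef := by
    intro W hW i
    rw [hT]
    have h1 := (hW i).mul_mul_conjTranspose_same (Amat η β (lam i))
    rw [Matrix.conjTranspose_eq_transpose_of_trivial] at h1
    refine h1.add (Qmat_psd.smul ?_)
    have h2 : ∀ j, 0 ≤ lam j ^ 2 * (W j : Matrix (Fin 2) (Fin 2) ℝ) 0 0 :=
      fun j => mul_nonneg (sq_nonneg _) (hW j).diag_nonneg
    exact mul_nonneg (sq_nonneg _) (add_nonneg (h2 i) (Finset.sum_nonneg fun j _ => h2 j))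
  refine ⟨hcone, ?_⟩
  let K : Set (Fin d → Sym2Mat) := {W | ∀ i, ((W i : Matrix (Fin 2) (Fin 2) ℝ)).PosSemidef}
  have hKiff : ∀ W : Fin d → Sym2Mat, W ∈ K ↔ ∀ i,
      0 ≤ (W i : Matrix (Fin 2) (Fin 2) ℝ) 0 0 ∧ 0 ≤ (W i : Matrix (Fin 2) (Fin 2) ℝ) 1 1 ∧
      (W i : Matrix (Fin 2) (Fin 2) ℝ) 0 1 ^ 2 ≤
        (W i : Matrix (Fin 2) (Fin 2) ℝ) 0 0 * (W i : Matrix (Fin 2) (Fin 2) ℝ) 1 1 :=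
    fun W => forall_congr' fun i => psd2_iff _ (W i).2
  have hKc : IsClosed K := by
    have : K = ⋂ i, {W : Fin d → Sym2Mat |
      0 ≤ (W i : Matrix (Fin 2) (Fin 2) ℝ) 0 0 ∧ 0 ≤ (W i : Matrix (Fin 2) (Fin 2) ℝ) 1 1 ∧
      (W i : Matrix (Fin 2) (Fin 2) ℝ) 0 1 ^ 2 ≤
        (W i : Matrix (Fin 2) (Fin 2) ℝ) 0 0 * (W i : Matrix (Fin 2) (Fin 2) ℝ) 1 1} := by
      ext W; rw [hKiff]; simp only [Set.mem_iInter, Set.mem_ofPred_eq]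
    rw [this]
    refine isClosed_iInter fun i => ?_
    exact (isClosed_le continuous_const (entry_continuous i 0 0)).and
      ((isClosed_le continuous_const (entry_continuous i 1 1)).and
      (isClosed_le ((entry_continuous i 0 1).pow 2)
        ((entry_continuous i 0 0).mul (entry_continuous i 1 1))))
  have hsym : ∀ X : Sym2Mat, (X : Matrix (Fin 2) (Fin 2) ℝ) 1 0 =
      (X : Matrix (Fin 2) (Fin 2) ℝ) 0 1 := fun X => Matrix.IsSymm.apply X.2 0 1
  have hφ : ∀ W ∈ K, ‖W‖ ≤ trL d W := by
    intro W hW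
    rw [hKiff] at hW
    rw [trL_apply]
    have hnn : ∀ i ∈ Finset.univ, 0 ≤ (W i : Matrix (Fin 2) (Fin 2) ℝ) 0 0 +
      (W i : Matrix (Fin 2) (Fin 2) ℝ) 1 1 := fun i _ => add_nonneg (hW i).1 (hW i).2.1
    rw [pi_norm_le_iff_of_nonneg (Finset.sum_nonneg hnn)]
    intro i
    refine le_trans ?_ (Finset.single_le_sum hnn (Finset.mem_univ i))
    obtain ⟨h0, h1, h2⟩ := hW i
    have h01 : |(W i : Matrix (Fin 2) (Fin 2) ℝ) 0 1| ≤
        (W i : Matrix (Fin 2) (Fin 2) ℝ) 0 0 + (W i : Matrix (Fin 2) (Fin 2) ℝ) 1 1 := by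
      apply abs_le_of_sq_le_sq _ (by linarith)
      nlinarith
    refine sym2_norm_le _ _ (by linarith) ?_
    intro a b
    fin_cases a <;> fin_cases b
    · simpa [abs_of_nonneg h0] using h1
    · exact h01
    · change |(W i : Matrix (Fin 2) (Fin 2) ℝ) 1 0| ≤ _
      rw [hsym]; exact h01
    · simpa [abs_of_nonneg h1] using h0
  let e : Fin d → Sym2Mat := fun _ => ⟨(2 : ℝ) • (1 : Matrix (Fin 2) (Fin 2) ℝ),
    Matrix.isSymm_one.smul 2⟩
  have he : ∀ W : Fin d → Sym2Mat, ‖W‖ ≤ 1 → e + W ∈ K := by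
    intro W hW
    rw [hKiff]
    intro i
    have hb : ∀ a b, |(W i : Matrix (Fin 2) (Fin 2) ℝ) a b| ≤ 1 := fun a b =>
      (sym2_entry_le (W i) a b).trans ((norm_le_pi_norm W i).trans hW)
    have e00 : ((e + W) i : Matrix (Fin 2) (Fin 2) ℝ) 0 0 =
      2 + (W i : Matrix (Fin 2) (Fin 2) ℝ) 0 0 := by simp [e]
    have e11 : ((e + W) i : Matrix (Fin 2) (Fin 2) ℝ) 1 1 =
      2 + (W i : Matrix (Fin 2) (Fin 2) ℝ) 1 1 := by simp [e]
    have e01 : ((e + W) i : Matrix (Fin 2) (Fin 2) ℝ) 0 1 =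
      (W i : Matrix (Fin 2) (Fin 2) ℝ) 0 1 := by simp [e]
    rw [e00, e11, e01]
    have a0 := abs_le.1 (hb 0 0)
    have a1 := abs_le.1 (hb 1 1)
    have a2 := abs_le.1 (hb 0 1)
    refine ⟨by linarith, by linarith, ?_⟩
    nlinarith
  have hQs : Qmat.IsSymm := by
    ext i j; fin_cases i <;> fin_cases j <;> simp [Qmat]
  let W : Fin d → Sym2Mat := fun _ => ⟨Qmat, hQs⟩
  have hWK : W ∈ K := fun i => Qmat_psd
  have hW0 : W ≠ 0 := by
    intro h
    have := congrArg (fun V : Fin d → Sym2Mat => entryL d ⟨0, hd⟩ 0 0 V) h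
    simp [entryL_apply, W, Qmat] at this
  have hTW : T W - (η ^ 2 * ∑ i, lam i ^ 2) • W ∈ K := by
    intro i
    have h1 : ((T W - (η ^ 2 * ∑ i, lam i ^ 2) • W) i : Matrix (Fin 2) (Fin 2) ℝ) =
        Amat η β (lam i) * Qmat * (Amat η β (lam i))ᵀ + (η ^ 2 * lam i ^ 2) • Qmat := by
      have h2 : ((T W - (η ^ 2 * ∑ i, lam i ^ 2) • W) i : Matrix (Fin 2) (Fin 2) ℝ) =
        (T W i : Matrix (Fin 2) (Fin 2) ℝ) - (η ^ 2 * ∑ i, lam i ^ 2) • Qmat := rfl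
      have hQ : Qmat 0 0 = 1 := by simp [Qmat]
      rw [h2, hT]
      simp only [W, hQ, mul_one]
      module
    rw [h1]
    have h3 := Qmat_psd.mul_mul_conjTranspose_same (Amat η β (lam i))
    rw [Matrix.conjTranspose_eq_transpose_of_trivial] at h3
    exact h3.add (Qmat_psd.smul (by positivity))
  obtain ⟨hsρ, X, hXK, hX1, hTX⟩ := kr_abstract K hKc
    (fun x hx y hy i => (hx i).add (hy i)) (fun c hc x hx i => (hx i).smul hc)
    (trL d) hφ e he T hcone ρ hρ W hWK hW0 _ hs hTW
  have hρ0 : 0 < ρ := hs.trans_le hsρ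
  have hX0 : X ≠ 0 := by rintro rfl; simp at hX1
  refine ⟨X, hX0, hXK, hTX, hsρ, hs, ?_⟩
  have hX' := (hKiff X).1 hXK
  refine lt_of_le_of_ne (Finset.sum_nonneg fun i _ => (hX' i).1) fun h => ?_
  have h00 := (Finset.sum_eq_zero_iff_of_nonneg (fun i _ => (hX' i).1)).1 h.symm
  have h11 : ∀ i, (X i : Matrix (Fin 2) (Fin 2) ℝ) 1 1 = 0 := by
    intro i
    have a00 : ∀ j, (X j : Matrix (Fin 2) (Fin 2) ℝ) 0 0 = 0 := fun j => h00 j (Finset.mem_univ j)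
    have a01 : (X i : Matrix (Fin 2) (Fin 2) ℝ) 0 1 = 0 := by
      have := (hX' i).2.2
      rw [a00, zero_mul] at this
      nlinarith [sq_nonneg ((X i : Matrix (Fin 2) (Fin 2) ℝ) 0 1)]
    have a10 := (hsym (X i)).trans a01
    have hXi : (X i : Matrix (Fin 2) (Fin 2) ℝ) =
        !![0, 0; 0, (X i : Matrix (Fin 2) (Fin 2) ℝ) 1 1] := by
      ext a b
      fin_cases a <;> fin_cases b <;> simp [a00, a01, a10]
    have hi := hT X i
    rw [hTX] at hi
    have hl : ((ρ • X) i : Matrix (Fin 2) (Fin 2) ℝ) = ρ • (X i : Matrix (Fin 2) (Fin 2) ℝ) := rfl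
    rw [hl] at hi
    generalize (X i : Matrix (Fin 2) (Fin 2) ℝ) 1 1 = w at *
    simp only [a00] at hi
    rw [hXi] at hi
    have b0 := congrFun (congrFun hi 0) 0
    have b1 := congrFun (congrFun hi 1) 1
    simp [Amat, Matrix.vecMul, dotProduct, Fin.sum_univ_two] at b0 b1
    have b2 : ρ * w = 0 := by
      rcases b0 with (h | h) | h <;> rw [b1, h] <;> ring
    exact (mul_eq_zero.1 b2).resolve_left hρ0.ne'
  rw [trL_apply] at hX1
  rw [Finset.sum_eq_zero] at hX1
  · exact zero_ne_one hX1
  · intro i hi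
    rw [h00 i hi, h11 i, add_zero]
end

section
/- Let T be the ZO-GDM covariance operator on (𝕊²)^d, and define S(η,β) := Σ_{i=1}^d η λ_i / (2(1−β)(1 − ηλ_i/(1−β²))). Then the spectral radius satisfies ρ(T) = 1 if and only if η λ_1 < 1 − β² and S(η,β) = 1. -/
open Matrix

open Filter Topology

/-- Quadratic form of a symmetric matrix. -/
def zqf (X : Sym2Mat) (s t : ℝ) : ℝ :=
  X.1 0 0 * s ^ 2 + (X.1 0 1 + X.1 1 0) * s * t + X.1 1 1 * t ^ 2

lemma zqf_add (X Y : Sym2Mat) (s t : ℝ) : zqf (X + Y) s t = zqf X s t + zqf Y s t := by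
  simp only [zqf, Submodule.coe_add, Matrix.add_apply]; ring

lemma zqf_sub (X Y : Sym2Mat) (s t : ℝ) : zqf (X - Y) s t = zqf X s t - zqf Y s t := by
  simp only [zqf, Submodule.coe_sub, Matrix.sub_apply]; ring

lemma zqf_smul (c : ℝ) (X : Sym2Mat) (s t : ℝ) : zqf (c • X) s t = c * zqf X s t := by
  simp only [zqf, Submodule.coe_smul, Matrix.smul_apply, smul_eq_mul]; ring

lemma zentry_le (X : Sym2Mat) (i j : Fin 2) : |X.1 i j| ≤ ‖X‖ := by
  have h1 : ‖(X.1 : Fin 2 → Fin 2 → ℝ) i‖ ≤ ‖X‖ :=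
    norm_le_pi_norm (X.1 : Fin 2 → Fin 2 → ℝ) i
  have h2 := norm_le_pi_norm ((X.1 : Fin 2 → Fin 2 → ℝ) i) j
  exact le_trans h2 h1

lemma znorm_le (X : Sym2Mat) (C : ℝ) (hC : 0 ≤ C) (h : ∀ i j, |X.1 i j| ≤ C) : ‖X‖ ≤ C := by
  have : ‖(X.1 : Fin 2 → Fin 2 → ℝ)‖ ≤ C :=
    (pi_norm_le_iff_of_nonneg hC).2 fun i => (pi_norm_le_iff_of_nonneg hC).2 fun j => h i j
  exact this

lemma zqf_abs_le (X : Sym2Mat) (s t : ℝ) : |zqf X s t| ≤ 2 * ‖X‖ * (s ^ 2 + t ^ 2) := by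
  have h00 := abs_le.1 (zentry_le X 0 0)
  have h01 := abs_le.1 (zentry_le X 0 1)
  have h10 := abs_le.1 (zentry_le X 1 0)
  have h11 := abs_le.1 (zentry_le X 1 1)
  unfold zqf
  generalize ‖X‖ = N at *
  rw [abs_le]
  have hs := sq_nonneg s
  have ht := sq_nonneg t
  have hp := sq_nonneg (s + t)
  have hm := sq_nonneg (s - t)
  constructor
  · nlinarith [mul_nonneg (sub_nonneg.2 h00.1) hs, mul_nonneg (sub_nonneg.2 h11.1) ht,
      mul_nonneg (sub_nonneg.2 h01.1) hp, mul_nonneg (sub_nonneg.2 h10.1) hp,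
      mul_nonneg (sub_nonneg.2 h01.2) hm, mul_nonneg (sub_nonneg.2 h10.2) hm]
  · nlinarith [mul_nonneg (sub_nonneg.2 h00.2) hs, mul_nonneg (sub_nonneg.2 h11.2) ht,
      mul_nonneg (sub_nonneg.2 h01.1) hm, mul_nonneg (sub_nonneg.2 h10.1) hm,
      mul_nonneg (sub_nonneg.2 h01.2) hp, mul_nonneg (sub_nonneg.2 h10.2) hp]

lemma znorm_le_of_zqf (X : Sym2Mat) (C : ℝ)
    (h : ∀ s t, |zqf X s t| ≤ C * (s ^ 2 + t ^ 2)) : ‖X‖ ≤ 2 * C := by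
  have hsym : X.1 1 0 = X.1 0 1 := (show X.1.IsSymm from X.2).apply 0 1
  have h0 := h 1 0
  have h1 := h 0 1
  have h2 := h 1 1
  simp only [zqf, hsym] at h0 h1 h2
  norm_num at h0 h1 h2
  have hC : 0 ≤ C := le_trans (abs_nonneg _) h0
  have k0 := abs_le.1 h0
  have k1 := abs_le.1 h1
  have k2 := abs_le.1 h2
  have h01 : |X.1 0 1| ≤ 2 * C := by rw [abs_le]; constructor <;> linarith
  apply znorm_le X _ (by linarith)
  intro i j
  fin_cases i <;> fin_cases j
  · exact h0.trans (by linarith)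
  · exact h01
  · show |X.1 1 0| ≤ _
    rw [hsym]; exact h01
  · exact h1.trans (by linarith)

/-- The product positive semidefinite cone. -/
def ZK {d : ℕ} (W : Fin d → Sym2Mat) : Prop := ∀ i s t, 0 ≤ zqf (W i) s t

lemma ZK.add {d : ℕ} {W V : Fin d → Sym2Mat} (h : ZK W) (k : ZK V) : ZK (W + V) := by
  intro i s t
  rw [Pi.add_apply, zqf_add]
  exact add_nonneg (h i s t) (k i s t)

lemma ZK.smul {d : ℕ} {W : Fin d → Sym2Mat} (h : ZK W) {c : ℝ} (hc : 0 ≤ c) : ZK (c • W) := by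
  intro i s t
  rw [Pi.smul_apply, zqf_smul]
  exact mul_nonneg hc (h i s t)

lemma zpow_pres {d : ℕ} (U : (Fin d → Sym2Mat) →L[ℝ] (Fin d → Sym2Mat))
    (hU : ∀ W, ZK W → ZK (U W)) (n : ℕ) : ∀ W, ZK W → ZK ((U ^ n) W) := by
  induction n with
  | zero => intro W h; simpa using h
  | succ k ih =>
    intro W h
    rw [pow_succ]
    exact ih _ (hU _ h)

lemma ziter_lower {d : ℕ} (U : (Fin d → Sym2Mat) →L[ℝ] (Fin d → Sym2Mat))
    (hU : ∀ W, ZK W → ZK (U W)) (W0 : Fin d → Sym2Mat) (c : ℝ) (hc : 0 ≤ c)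
    (h : ZK (U W0 - c • W0)) (n : ℕ) : ZK ((U ^ n) W0 - c ^ n • W0) := by
  induction n with
  | zero => intro i s t; simp [zqf]
  | succ k ih =>
    have e : (U ^ (k + 1)) W0 - c ^ (k + 1) • W0
        = U ((U ^ k) W0 - c ^ k • W0) + c ^ k • (U W0 - c • W0) := by
      rw [pow_succ', mul_apply_eq_comp, map_sub, map_smul, smul_sub, smul_smul,
        ← pow_succ]
      abel
    rw [e]
    exact (hU _ ih).add (h.smul (pow_nonneg hc k))

lemma ziter_upper {d : ℕ} (U : (Fin d → Sym2Mat) →L[ℝ] (Fin d → Sym2Mat))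
    (hU : ∀ W, ZK W → ZK (U W)) (W0 : Fin d → Sym2Mat) (c : ℝ) (hc : 0 ≤ c)
    (h : ZK (c • W0 - U W0)) (n : ℕ) : ZK (c ^ n • W0 - (U ^ n) W0) := by
  induction n with
  | zero => intro i s t; simp [zqf]
  | succ k ih =>
    have e : c ^ (k + 1) • W0 - (U ^ (k + 1)) W0
        = U (c ^ k • W0 - (U ^ k) W0) + c ^ k • (c • W0 - U W0) := by
      rw [pow_succ' U, mul_apply_eq_comp, map_sub, map_smul, smul_sub, smul_smul,
        ← pow_succ]
      abel
    rw [e]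
    exact (hU _ ih).add (h.smul (pow_nonneg hc k))

lemma zlim_aux (K c : ℝ) (hK : 0 < K) (hc : 0 ≤ c) :
    Tendsto (fun n : ℕ => (K * c ^ n) ^ (((2 * n : ℕ) : ℝ)⁻¹)) atTop (𝓝 (√c)) := by
  have h2 : Tendsto (fun n : ℕ => ((2 * n : ℕ) : ℝ)⁻¹) atTop (𝓝 0) :=
    tendsto_inv_atTop_zero.comp (tendsto_natCast_atTop_atTop.comp
      (tendsto_id.const_mul_atTop' (by norm_num : 0 < 2)))
  have h3 : Tendsto (fun n : ℕ => K ^ (((2 * n : ℕ) : ℝ)⁻¹) * √c) atTop (𝓝 (K ^ (0 : ℝ) * √c)) :=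
    (tendsto_const_nhds.rpow h2 (Or.inl hK.ne')).mul_const _
  rw [Real.rpow_zero, one_mul] at h3
  refine h3.congr' ?_
  filter_upwards [eventually_ge_atTop 1] with n hn
  rw [Real.mul_rpow hK.le (pow_nonneg hc n)]
  congr 1
  have hn' : (n : ℝ) ≠ 0 := by positivity
  rw [Real.sqrt_eq_rpow, ← Real.rpow_natCast, ← Real.rpow_mul hc]
  congr 1
  push_cast
  field_simp

lemma zlim_upper (f : ℕ → ℝ) (hf : ∀ n, 0 ≤ f n) (ρ K c : ℝ) (hK : 0 < K) (hc : 0 ≤ c)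
    (hρ : Tendsto (fun n : ℕ => f n ^ ((n : ℝ)⁻¹)) atTop (𝓝 ρ))
    (h : ∀ n, f (2 * n) ≤ K * c ^ n) : ρ ≤ √c := by
  have h1 := hρ.comp (tendsto_id.const_mul_atTop' (by norm_num : 0 < 2))
  refine le_of_tendsto_of_tendsto' h1 (zlim_aux K c hK hc) fun n => ?_
  exact Real.rpow_le_rpow (hf _) (h n) (by positivity)

lemma zlim_lower (f : ℕ → ℝ) (ρ K c : ℝ) (hK : 0 < K) (hc : 0 ≤ c)
    (hρ : Tendsto (fun n : ℕ => f n ^ ((n : ℝ)⁻¹)) atTop (𝓝 ρ))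
    (h : ∀ n, K * c ^ n ≤ f (2 * n)) : √c ≤ ρ := by
  have h1 := hρ.comp (tendsto_id.const_mul_atTop' (by norm_num : 0 < 2))
  refine le_of_tendsto_of_tendsto' (zlim_aux K c hK hc) h1 fun n => ?_
  exact Real.rpow_le_rpow (by positivity) (h n) (by positivity)

lemma zrho_le {d : ℕ} (T : (Fin d → Sym2Mat) →L[ℝ] (Fin d → Sym2Mat))
    (hTK : ∀ W, ZK W → ZK (T W)) (ρ : ℝ)
    (hρ : Tendsto (fun n : ℕ => ‖T ^ n‖ ^ ((n : ℝ)⁻¹)) atTop (𝓝 ρ))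
    (W0 : Fin d → Sym2Mat) (δ c : ℝ) (hδ : 0 < δ) (hc : 0 ≤ c)
    (hW0 : ∀ i s t, δ * (s ^ 2 + t ^ 2) ≤ zqf (W0 i) s t)
    (h : ZK (c • W0 - T (T W0))) : ρ ≤ √c := by
  refine zlim_upper (fun n => ‖T ^ n‖) (fun n => ContinuousLinearMap.opNorm_nonneg _) ρ (8 * ‖W0‖ / δ + 1) c
    (by positivity) hc hρ fun n => ?_
  have hU : ∀ W, ZK W → ZK ((T ^ 2) W) := zpow_pres T hTK 2
  have hh : ZK (c • W0 - (T ^ 2) W0) := by rw [pow_two]; exact h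
  have hup := ziter_upper (T ^ 2) hU W0 c hc hh n
  show ‖T ^ (2 * n)‖ ≤ _
  rw [pow_mul]
  have hcn := pow_nonneg hc n
  refine ContinuousLinearMap.opNorm_le_bound _ (by positivity) fun W => ?_
  have hm : ∀ i s t, |zqf (W i) s t| ≤ 2 * ‖W‖ / δ * zqf (W0 i) s t := by
    intro i s t
    calc |zqf (W i) s t| ≤ 2 * ‖W i‖ * (s ^ 2 + t ^ 2) := zqf_abs_le _ _ _
      _ ≤ 2 * ‖W‖ * (s ^ 2 + t ^ 2) := by gcongr; exact norm_le_pi_norm W i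
      _ = 2 * ‖W‖ / δ * (δ * (s ^ 2 + t ^ 2)) := by field_simp
      _ ≤ _ := by gcongr; exact hW0 i s t
  set m := 2 * ‖W‖ / δ with hmdef
  have hm0 : 0 ≤ m := by positivity
  have k1 : ZK (m • W0 - W) := fun i s t => by
    rw [Pi.sub_apply, zqf_sub, Pi.smul_apply, zqf_smul]
    linarith [(abs_le.1 (hm i s t)).2]
  have k2 : ZK (m • W0 + W) := fun i s t => by
    rw [Pi.add_apply, zqf_add, Pi.smul_apply, zqf_smul]
    linarith [(abs_le.1 (hm i s t)).1]
  have k1' := zpow_pres _ hU n _ k1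
  have k2' := zpow_pres _ hU n _ k2
  have hb : ∀ i, ‖((T ^ 2) ^ n) W i‖ ≤ 2 * (m * (c ^ n * (2 * ‖W0‖))) := by
    intro i
    apply znorm_le_of_zqf
    intro s t
    have a1 := k1' i s t
    have a2 := k2' i s t
    have a3 := hup i s t
    rw [map_sub, map_smul, Pi.sub_apply, zqf_sub, Pi.smul_apply, zqf_smul] at a1
    rw [map_add, map_smul, Pi.add_apply, zqf_add, Pi.smul_apply, zqf_smul] at a2
    rw [Pi.sub_apply, zqf_sub, Pi.smul_apply, zqf_smul] at a3
    have a4 : zqf (W0 i) s t ≤ 2 * ‖W0‖ * (s ^ 2 + t ^ 2) :=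
      (le_abs_self _).trans ((zqf_abs_le _ _ _).trans (by gcongr; exact norm_le_pi_norm W0 i))
    have a5 : m * zqf (((T ^ 2) ^ n) W0 i) s t
        ≤ m * (c ^ n * (2 * ‖W0‖)) * (s ^ 2 + t ^ 2) := by
      calc m * zqf (((T ^ 2) ^ n) W0 i) s t ≤ m * (c ^ n * (2 * ‖W0‖ * (s ^ 2 + t ^ 2))) := by
            apply mul_le_mul_of_nonneg_left _ hm0
            linarith [mul_le_mul_of_nonneg_left a4 hcn]
        _ = _ := by ring
    rw [abs_le]; constructor <;> linarith
  refine (pi_norm_le_iff_of_nonneg (by positivity)).2 fun i => (hb i).trans ?_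
  have e : 2 * (m * (c ^ n * (2 * ‖W0‖))) = 8 * ‖W0‖ / δ * c ^ n * ‖W‖ := by
    rw [hmdef]; field_simp; ring
  rw [e]
  gcongr
  linarith

lemma zrho_ge {d : ℕ} (T : (Fin d → Sym2Mat) →L[ℝ] (Fin d → Sym2Mat))
    (hTK : ∀ W, ZK W → ZK (T W)) (ρ : ℝ)
    (hρ : Tendsto (fun n : ℕ => ‖T ^ n‖ ^ ((n : ℝ)⁻¹)) atTop (𝓝 ρ))
    (W0 : Fin d → Sym2Mat) (c : ℝ) (hc : 0 ≤ c) (i : Fin d)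
    (hW0 : 0 < zqf (W0 i) 1 0)
    (h : ZK (T (T W0) - c • W0)) : √c ≤ ρ := by
  have hN : 0 < ‖W0‖ := by
    have := (le_abs_self _).trans (zqf_abs_le (W0 i) 1 0)
    have := norm_le_pi_norm W0 i
    linarith
  refine zlim_lower (fun n => ‖T ^ n‖) ρ (zqf (W0 i) 1 0 / (2 * ‖W0‖)) c
    (by positivity) hc hρ fun n => ?_
  have hU : ∀ W, ZK W → ZK ((T ^ 2) W) := zpow_pres T hTK 2
  have hh : ZK ((T ^ 2) W0 - c • W0) := by rw [pow_two]; exact h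
  have hlo := ziter_lower (T ^ 2) hU W0 c hc hh n i 1 0
  show _ ≤ ‖T ^ (2 * n)‖
  rw [pow_mul]
  rw [Pi.sub_apply, zqf_sub, Pi.smul_apply, zqf_smul] at hlo
  have b1 := (le_abs_self _).trans (zqf_abs_le (((T ^ 2) ^ n) W0 i) 1 0)
  have b2 := norm_le_pi_norm (((T ^ 2) ^ n) W0) i
  have b3 := ((T ^ 2) ^ n).le_opNorm W0
  rw [div_mul_eq_mul_div, div_le_iff₀ (by positivity)]
  linarith

/-- The operator identity in terms of quadratic forms. -/
def ZT {d : ℕ} (η β : ℝ) (lam : Fin d → ℝ)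
    (T : (Fin d → Sym2Mat) →L[ℝ] (Fin d → Sym2Mat)) : Prop :=
  ∀ W i s t, zqf (T W i) s t
    = zqf (W i) ((1 - η * lam i) * s + η * lam i * t) (β * (t - s))
      + ((η * lam i) ^ 2 * zqf (W i) 1 0 + ∑ j, (η * lam j) ^ 2 * zqf (W j) 1 0) * (s - t) ^ 2

lemma ZT.pres {d : ℕ} {η β : ℝ} {lam : Fin d → ℝ}
    {T : (Fin d → Sym2Mat) →L[ℝ] (Fin d → Sym2Mat)} (h : ZT η β lam T) :
    ∀ W, ZK W → ZK (T W) := by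
  intro W hW i s t
  rw [h]
  have := Finset.sum_nonneg fun j (_ : j ∈ Finset.univ) =>
    mul_nonneg (sq_nonneg (η * lam j)) (hW j 1 0)
  have h1 := hW i 1 0
  have h2 := hW i ((1 - η * lam i) * s + η * lam i * t) (β * (t - s))
  positivity

lemma zT_of {d : ℕ} (η β : ℝ) (lam : Fin d → ℝ)
    (T : (Fin d → Sym2Mat) →L[ℝ] (Fin d → Sym2Mat))
    (hT : ∀ (W : Fin d → Sym2Mat) (i : Fin d),
      ((T W i : Matrix (Fin 2) (Fin 2) ℝ))
        = Amat η β (lam i) * (W i : Matrix (Fin 2) (Fin 2) ℝ) * (Amat η β (lam i))ᵀ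
          + (η ^ 2 * (lam i ^ 2 * (W i : Matrix (Fin 2) (Fin 2) ℝ) 0 0
              + ∑ j, lam j ^ 2 * (W j : Matrix (Fin 2) (Fin 2) ℝ) 0 0)) • Qmat) :
    ZT η β lam T := by
  intro W i s t
  have e : ∑ j, (η * lam j) ^ 2 * zqf (W j) 1 0
      = η ^ 2 * ∑ j, lam j ^ 2 * (W j : Matrix (Fin 2) (Fin 2) ℝ) 0 0 := by
    rw [Finset.mul_sum]
    refine Finset.sum_congr rfl fun j _ => ?_
    simp only [zqf]; ring
  rw [e]
  simp only [zqf, hT]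
  generalize (∑ j, lam j ^ 2 * (W j : Matrix (Fin 2) (Fin 2) ℝ) 0 0) = S
  simp [Amat, Qmat, Matrix.mul_apply, Fin.sum_univ_two, Matrix.transpose_apply, Matrix.vecMul,
    dotProduct]
  ring

/-- Build a symmetric matrix. -/
def zmk (x y z : ℝ) : Sym2Mat :=
  ⟨!![x, y; y, z], by
    show Matrix.IsSymm _
    ext i j; fin_cases i <;> fin_cases j <;> rfl⟩

lemma zqf_mk (x y z s t : ℝ) : zqf (zmk x y z) s t = x * s ^ 2 + 2 * y * s * t + z * t ^ 2 := by
  show x * s ^ 2 + (y + y) * s * t + z * t ^ 2 = _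
  ring

/-- The stationary shape. -/
noncomputable def zX (a β x : ℝ) : Sym2Mat := zmk x (-(a * x / (1 + β))) (2 * a * x / (1 + β))

lemma zqf_X_step (a β x s t : ℝ) (hβ : 0 ≤ β) :
    zqf (zX a β x) ((1 - a) * s + a * t) (β * (t - s))
      = zqf (zX a β x) s t - x * (2 * a * (1 - β) - a ^ 2 * (1 - β) / (1 + β)) * (s - t) ^ 2 := by
  have : 1 + β ≠ 0 := by positivity
  simp only [zX, zqf_mk]
  field_simp
  ring

lemma zqf_X_one (a β x : ℝ) : zqf (zX a β x) 1 0 = x := by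
  simp [zX, zqf_mk]

lemma zqf_X_lower (a β x s t : ℝ) (hβ : 0 ≤ β) (ha : 0 < a) (ha1 : a < 1) (hx : 0 ≤ x) :
    x * (a / (1 + β) * (1 - a / (1 + β))) * (s ^ 2 + t ^ 2) ≤ zqf (zX a β x) s t := by
  have h0 : 0 < a / (1 + β) := by positivity
  have h1 : a / (1 + β) < 1 := by rw [div_lt_one (by positivity)]; linarith
  have e : zqf (zX a β x) s t = x * (s ^ 2 - 2 * (a / (1 + β)) * s * t + 2 * (a / (1 + β)) * t ^ 2) := by
    simp only [zX, zqf_mk]; ring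
  rw [e, mul_assoc]
  generalize a / (1 + β) = h at *
  apply mul_le_mul_of_nonneg_left _ hx
  have p1 : 0 ≤ (1 - h) * (1 - h) * s ^ 2 := by positivity
  have p2 : 0 ≤ h * h * t ^ 2 := by positivity
  have p3 : 0 ≤ h * (s - t) ^ 2 := by positivity
  nlinarith

/-- `e_i Q`. -/
def zE {d : ℕ} (e : Fin d → ℝ) : Fin d → Sym2Mat := fun i => zmk (e i) (-e i) (e i)

lemma zqf_E {d : ℕ} (e : Fin d → ℝ) (i : Fin d) (s t : ℝ) :
    zqf (zE e i) s t = e i * (s - t) ^ 2 := by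
  simp only [zE, zqf_mk]; ring

/-- `E + T E` dominates a multiple of the identity. -/
lemma zE_TE {d : ℕ} {η β : ℝ} {lam : Fin d → ℝ}
    {T : (Fin d → Sym2Mat) →L[ℝ] (Fin d → Sym2Mat)} (h : ZT η β lam T)
    (hβ0 : 0 ≤ β) (hβ1 : β < 1)
    (e : Fin d → ℝ) (he : ∀ i, 0 ≤ e i) (i : Fin d) (ha0 : 0 < η * lam i) (ha1 : η * lam i < 1)
    (s t : ℝ) :
    e i * (s ^ 2 + t ^ 2) ≤ 14 * (zqf (zE e i) s t + zqf (T (zE e) i) s t) := by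
  rw [h, zqf_E, zqf_E]
  have q1 : 0 ≤ ∑ j, (η * lam j) ^ 2 * zqf (zE e j) 1 0 :=
    Finset.sum_nonneg fun j _ => by
      rw [zqf_E]; have := he j; positivity
  have hei := he i
  have q2 : 0 ≤ ((η * lam i) ^ 2 * zqf (zE e i) 1 0
      + ∑ j, (η * lam j) ^ 2 * zqf (zE e j) 1 0) * (s - t) ^ 2 := by
    rw [zqf_E]; positivity
  set b := η * lam i - β with hb
  have e1 : (1 - η * lam i) * s + η * lam i * t - β * (t - s) = s - b * (s - t) := by
    rw [hb]; ring
  rw [e1]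
  have hb1 : b ^ 2 ≤ 1 := by rw [sq_le_one_iff_abs_le_one, abs_le]; constructor <;> linarith
  have hb2 : (1 - b) ^ 2 ≤ 4 := by nlinarith
  have key : s ^ 2 + t ^ 2 ≤ 14 * ((s - t) ^ 2 + (s - b * (s - t)) ^ 2) := by
    set p := s - t with hp
    set r := s - b * p with hr
    have hs : s = r + b * p := by rw [hr]; ring
    have ht : t = r - (1 - b) * p := by rw [hr, hp]; ring
    have u1 : s ^ 2 ≤ 2 * r ^ 2 + 2 * (b ^ 2 * p ^ 2) := by
      rw [hs]; nlinarith [sq_nonneg (r - b * p)]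
    have u2 : t ^ 2 ≤ 2 * r ^ 2 + 2 * ((1 - b) ^ 2 * p ^ 2) := by
      rw [ht]; nlinarith [sq_nonneg (r + (1 - b) * p)]
    have u3 := mul_le_mul_of_nonneg_right hb1 (sq_nonneg p)
    have u4 := mul_le_mul_of_nonneg_right hb2 (sq_nonneg p)
    nlinarith [sq_nonneg r, sq_nonneg p]
  have := mul_le_mul_of_nonneg_left key hei
  linarith

lemma zsuper {d : ℕ} {η β : ℝ} {lam : Fin d → ℝ}
    {T : (Fin d → Sym2Mat) →L[ℝ] (Fin d → Sym2Mat)} (h : ZT η β lam T)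
    (hβ0 : 0 ≤ β) (hβ1 : β < 1) (hpos : ∀ i, 0 < η * lam i)
    (ρ : ℝ) (hρ : Tendsto (fun n : ℕ => ‖T ^ n‖ ^ ((n : ℝ)⁻¹)) atTop (𝓝 ρ))
    (e : Fin d → ℝ) (he : ∀ i, 0 ≤ e i) (ha1 : ∀ i, 0 < e i → η * lam i < 1)
    (W0 : Fin d → Sym2Mat) (M κ : ℝ) (hM : 0 < M) (hκ : 0 < κ)
    (hWM : ∀ i s t, zqf (W0 i) s t ≤ M * (e i * (s ^ 2 + t ^ 2)))
    (i : Fin d) (hW0 : 0 < zqf (W0 i) 1 0)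
    (hs : ZK (T W0 - W0 - κ • zE e)) : 1 < ρ := by
  have hc : 1 < 1 + κ / (14 * M) := by
    have : 0 < κ / (14 * M) := by positivity
    linarith
  refine lt_of_lt_of_le ?_
    (zrho_ge T h.pres ρ hρ W0 (1 + κ / (14 * M)) (by positivity) i hW0 ?_)
  · rw [Real.lt_sqrt (by norm_num)]; linarith
  intro i s t
  have a1 := hs i s t
  have a2 := h.pres _ hs i s t
  simp only [map_sub, map_smul, Pi.sub_apply, zqf_sub, Pi.smul_apply, zqf_smul] at a1 a2 ⊢
  have a4 : e i * (s ^ 2 + t ^ 2) ≤ 14 * (zqf (zE e i) s t + zqf (T (zE e) i) s t) := by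
    rcases (he i).eq_or_lt with h0 | h0
    · have b1 : 0 ≤ zqf (zE e i) s t := by rw [zqf_E, ← h0]; simp
      have b2 : 0 ≤ zqf (T (zE e) i) s t := h.pres (zE e) (fun j s t => by
        rw [zqf_E]; have := he j; positivity) i s t
      rw [← h0]; linarith
    · exact zE_TE h hβ0 hβ1 e he i (hpos i) (ha1 i h0) s t
  have a5 : κ / (14 * M) * zqf (W0 i) s t
      ≤ κ * (zqf (zE e i) s t + zqf (T (zE e) i) s t) := by
    calc κ / (14 * M) * zqf (W0 i) s t
        ≤ κ / (14 * M) * (M * (14 * (zqf (zE e i) s t + zqf (T (zE e) i) s t))) := by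
          have := hWM i s t
          have := mul_le_mul_of_nonneg_left a4 hM.le
          gcongr
          linarith
      _ = _ := by field_simp
  linarith

lemma zsub {d : ℕ} {η β : ℝ} {lam : Fin d → ℝ}
    {T : (Fin d → Sym2Mat) →L[ℝ] (Fin d → Sym2Mat)} (h : ZT η β lam T)
    (hβ0 : 0 ≤ β) (hβ1 : β < 1) (hpos : ∀ i, 0 < η * lam i) (ha1 : ∀ i, η * lam i < 1)
    (ρ : ℝ) (hρ : Tendsto (fun n : ℕ => ‖T ^ n‖ ^ ((n : ℝ)⁻¹)) atTop (𝓝 ρ))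
    (W0 : Fin d → Sym2Mat) (M κ δ : ℝ) (hM : 0 < M) (hκ : 0 < κ) (hδ : 0 < δ)
    (hWδ : ∀ i s t, δ * (s ^ 2 + t ^ 2) ≤ zqf (W0 i) s t)
    (hWM : ∀ i s t, zqf (W0 i) s t ≤ M * (s ^ 2 + t ^ 2))
    (hs : ZK (W0 - T W0 - κ • zE (fun _ => 1))) : ρ < 1 := by
  have hc : max 0 (1 - κ / (14 * M)) < 1 := by
    have : 0 < κ / (14 * M) := by positivity
    rw [max_lt_iff]; constructor <;> linarith
  refine lt_of_le_of_lt
    (zrho_le T h.pres ρ hρ W0 δ (max 0 (1 - κ / (14 * M))) hδ (le_max_left _ _) hWδ ?_) ?_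
  swap
  · rw [Real.sqrt_lt' (by norm_num)]; linarith
  intro i s t
  have a1 := hs i s t
  have a2 := h.pres _ hs i s t
  simp only [map_sub, map_smul, Pi.sub_apply, zqf_sub, Pi.smul_apply, zqf_smul] at a1 a2 ⊢
  have a4 := zE_TE h hβ0 hβ1 (fun _ => 1) (fun _ => by norm_num) i (hpos i) (ha1 i) s t
  set E : Fin d → Sym2Mat := zE (fun _ => 1)
  have a5 : κ / (14 * M) * zqf (W0 i) s t
      ≤ κ * (zqf (E i) s t + zqf (T E i) s t) := by
    calc κ / (14 * M) * zqf (W0 i) s t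
        ≤ κ / (14 * M) * (M * (14 * (zqf (E i) s t + zqf (T E i) s t))) := by
          have := hWM i s t
          have := mul_le_mul_of_nonneg_left a4 hM.le
          gcongr
          linarith
      _ = _ := by field_simp
  have a6 : 0 ≤ zqf (W0 i) s t := le_trans (by positivity) (hWδ i s t)
  have a7 := mul_le_mul_of_nonneg_right (le_max_right 0 (1 - κ / (14 * M))) a6
  linarith

/-- **Critical case for the ZO-GDM covariance operator.**  Let `T` be the ZO-GDM
covariance operator on `(𝕊²)^d` and `ρ` its spectral radius (the limit of `‖Tⁿ‖^{1/n}`).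
With `S(η,β) = Σ_i η λ_i / (2(1−β)(1 − ηλ_i/(1−β²)))`, one has
`ρ = 1 ↔ η λ_1 < 1 − β² ∧ S(η,β) = 1`. -/
theorem zogdm_cov_operator_spectral_radius_eq_one {d : ℕ} (hd : 0 < d)
    (η β : ℝ) (hη : 0 < η) (hβ : β ∈ Set.Ico (0 : ℝ) 1)
    (lam : Fin d → ℝ) (hmono : Antitone lam) (hpos : ∀ i, 0 < lam i)
    (T : (Fin d → Sym2Mat) →L[ℝ] (Fin d → Sym2Mat))
    (hT : ∀ (W : Fin d → Sym2Mat) (i : Fin d),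
      ((T W i : Matrix (Fin 2) (Fin 2) ℝ))
        = Amat η β (lam i) * (W i : Matrix (Fin 2) (Fin 2) ℝ) * (Amat η β (lam i))ᵀ
          + (η ^ 2 * (lam i ^ 2 * (W i : Matrix (Fin 2) (Fin 2) ℝ) 0 0
              + ∑ j, lam j ^ 2 * (W j : Matrix (Fin 2) (Fin 2) ℝ) 0 0)) • Qmat)
    (ρ : ℝ)
    (hρ : Filter.Tendsto (fun n : ℕ => ‖T ^ n‖ ^ ((n : ℝ)⁻¹)) Filter.atTop (nhds ρ)) :
    ρ = 1 ↔ η * lam ⟨0, hd⟩ < 1 - β ^ 2 ∧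
      ∑ i, η * lam i / (2 * (1 - β) * (1 - η * lam i / (1 - β ^ 2))) = 1 := by
  obtain ⟨hβ0, hβ1⟩ := hβ
  have hZ := zT_of η β lam T hT
  have hβ2 : 0 < 1 - β ^ 2 := by nlinarith
  have hβ3 : 0 < 1 - β := by linarith
  have ha : ∀ i, 0 < η * lam i := fun i => mul_pos hη (hpos i)
  set i0 : Fin d := ⟨0, hd⟩ with hi0
  have hle : ∀ i, η * lam i ≤ η * lam i0 := fun i =>
    mul_le_mul_of_nonneg_left (hmono (Fin.mk_le_of_le_val (Nat.zero_le _))) hη.le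
  by_cases hcrit : η * lam i0 < 1 - β ^ 2
  · -- all modes below threshold
    have hlt : ∀ i, η * lam i < 1 - β ^ 2 := fun i => (hle i).trans_lt hcrit
    have hlt1 : ∀ i, η * lam i < 1 := fun i => (hlt i).trans_le (by nlinarith)
    have hD : ∀ i, 0 < 1 - η * lam i / (1 - β ^ 2) := fun i => by
      rw [sub_pos, div_lt_one hβ2]; exact hlt i
    set S := ∑ i, η * lam i / (2 * (1 - β) * (1 - η * lam i / (1 - β ^ 2))) with hS
    let x : Fin d → ℝ := fun i =>
      1 / (2 * (η * lam i) * (1 - β) * (1 - η * lam i / (1 - β ^ 2)))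
    have hx : ∀ i, 0 < x i := fun i => by
      have := ha i; have := hD i
      simp only [x]; positivity
    let W0 : Fin d → Sym2Mat := fun i => zX (η * lam i) β (x i)
    have hSx : ∑ j, (η * lam j) ^ 2 * zqf (W0 j) 1 0 = S := by
      rw [hS]
      refine Finset.sum_congr rfl fun j _ => ?_
      have h1 := (ha j).ne'; have h2 := (hD j).ne'
      simp only [W0, zqf_X_one, x]
      generalize 1 - η * lam j / (1 - β ^ 2) = D at *
      generalize η * lam j = a at *
      field_simp
    have hTW : ∀ i s t, zqf (T W0 i) s t = zqf (W0 i) s t + (S - 1) * (s - t) ^ 2 := by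
      intro i s t
      rw [hZ, hSx]
      simp only [W0, zqf_X_step _ _ _ _ _ hβ0, zqf_X_one]
      have k : x i * (2 * (η * lam i) * (1 - β) * (1 - η * lam i / (1 - β ^ 2))) = 1 := by
        have h1 := (ha i); have h2 := (hD i)
        exact one_div_mul_cancel (by positivity)
      have k2 : 2 * (η * lam i) * (1 - β) * (1 - η * lam i / (1 - β ^ 2))
          = 2 * (η * lam i) * (1 - β) - (η * lam i) ^ 2 * (1 - β) / (1 + β) - (η * lam i) ^ 2 := by
        have : 1 - β ^ 2 = (1 - β) * (1 + β) := by ring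
        rw [this]
        have h3 : 1 + β ≠ 0 := by positivity
        have h4 := hβ3.ne'
        field_simp
        ring
      rw [k2] at k
      linear_combination (-(s - t) ^ 2) * k
    have hlow : ∃ δ > 0, ∀ i s t, δ * (s ^ 2 + t ^ 2) ≤ zqf (W0 i) s t := by
      let g : Fin d → ℝ := fun i =>
        x i * (η * lam i / (1 + β) * (1 - η * lam i / (1 + β)))
      obtain ⟨k, -, hk⟩ := Finset.exists_min_image Finset.univ g ⟨i0, Finset.mem_univ _⟩
      refine ⟨g k, ?_, fun i s t => ?_⟩
      · have h1 : η * lam k / (1 + β) < 1 := by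
          rw [div_lt_one (by positivity)]; linarith [hlt1 k]
        have h2 : 0 < 1 - η * lam k / (1 + β) := by linarith
        have h3 := hx k; have h4 := ha k
        simp only [g]; positivity
      · exact (mul_le_mul_of_nonneg_right (hk i (Finset.mem_univ _)) (by positivity)).trans
          (zqf_X_lower _ _ _ _ _ hβ0 (ha i) (hlt1 i) (hx i).le)
    obtain ⟨δ, hδ, hWδ⟩ := hlow
    have hWM : ∀ i s t, zqf (W0 i) s t ≤ (2 * ‖W0‖ + 1) * (s ^ 2 + t ^ 2) := fun i s t =>
      (le_abs_self _).trans ((zqf_abs_le _ _ _).trans (by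
        have := norm_le_pi_norm W0 i
        gcongr; linarith))
    have hW1 : 0 < zqf (W0 i0) 1 0 := by simp only [W0, zqf_X_one]; exact hx i0
    have hM : 0 < 2 * ‖W0‖ + 1 := by positivity
    rcases lt_trichotomy S 1 with hS1 | hS1 | hS1
    · have : ρ < 1 := zsub hZ hβ0 hβ1 ha hlt1 ρ hρ W0 _ (1 - S) δ hM (by linarith) hδ hWδ hWM
        (fun i s t => by
          simp only [Pi.sub_apply, zqf_sub, Pi.smul_apply, zqf_smul, zqf_E, hTW]
          linarith)
      exact ⟨fun h => absurd h this.ne, fun h => absurd h.2 hS1.ne⟩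
    · have hfix : ∀ i s t, zqf (T (T W0) i) s t = zqf (W0 i) s t := by
        have h0 : ZK (T W0 - W0) := fun i s t => by
          rw [Pi.sub_apply, zqf_sub, hTW, hS1]; linarith
        have h1 : ZK (W0 - T W0) := fun i s t => by
          rw [Pi.sub_apply, zqf_sub, hTW, hS1]; linarith
        intro i s t
        have a0 := hZ.pres _ h0 i s t
        have a1 := hZ.pres _ h1 i s t
        rw [map_sub, Pi.sub_apply, zqf_sub] at a0 a1
        have a2 := hTW i s t
        rw [hS1] at a2
        linarith
      have u := zrho_le T hZ.pres ρ hρ W0 δ 1 hδ (by norm_num) hWδ (fun i s t => by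
        rw [one_smul, Pi.sub_apply, zqf_sub, hfix, sub_self])
      have l := zrho_ge T hZ.pres ρ hρ W0 1 (by norm_num) i0 hW1 (fun i s t => by
        rw [one_smul, Pi.sub_apply, zqf_sub, hfix, sub_self])
      rw [Real.sqrt_one] at u l
      exact ⟨fun _ => ⟨hcrit, hS1⟩, fun _ => le_antisymm u l⟩
    · have : 1 < ρ := zsuper hZ hβ0 hβ1 ha ρ hρ (fun _ => 1) (fun _ => by norm_num)
        (fun i _ => hlt1 i) W0 _ (S - 1) hM (by linarith)
        (fun i s t => by rw [one_mul]; exact hWM i s t) i0 hW1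
        (fun i s t => by
          simp only [Pi.sub_apply, zqf_sub, Pi.smul_apply, zqf_smul, zqf_E, hTW]
          linarith)
      exact ⟨fun h => absurd h this.ne', fun h => absurd h.2 hS1.ne'⟩
  · -- first mode above threshold
    suffices 1 < ρ from ⟨fun h => absurd h this.ne', fun h => absurd h.1 hcrit⟩
    push Not at hcrit
    let e : Fin d → ℝ := fun i => if i = i0 then 1 else 0
    have he : ∀ i, 0 ≤ e i := fun i => by simp only [e]; split_ifs <;> norm_num
    have he0 : e i0 = 1 := by simp [e]
    have hsum : ∀ W : Fin d → Sym2Mat, (∀ j, j ≠ i0 → zqf (W j) 1 0 = 0) →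
        ∑ j, (η * lam j) ^ 2 * zqf (W j) 1 0 = (η * lam i0) ^ 2 * zqf (W i0) 1 0 := by
      intro W hW
      refine Finset.sum_eq_single i0 (fun j _ hj => ?_) (fun h => absurd (Finset.mem_univ _) h)
      rw [hW j hj, mul_zero]
    by_cases h1 : 1 ≤ η * lam i0
    · have hEK : ZK (zE e) := fun i s t => by
        rw [zqf_E]; have := he i; positivity
      have hs : ZK (T (zE e) - (2 : ℝ) • zE e) := by
        intro i s t
        simp only [Pi.sub_apply, zqf_sub, Pi.smul_apply, zqf_smul]
        by_cases hi : i = i0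
        · rw [hi]
          rw [hZ, hsum (zE e) (fun j hj => by rw [zqf_E]; simp [e, hj])]
          simp only [zqf_E, he0]
          have : 1 ≤ (η * lam i0) ^ 2 := one_le_pow₀ h1
          nlinarith [mul_nonneg (sub_nonneg.2 this) (sq_nonneg (s - t)),
            sq_nonneg ((1 - η * lam i0) * s + η * lam i0 * t - β * (t - s))]
        · have h2 : zqf (zE e i) s t = 0 := by rw [zqf_E]; simp [e, hi]
          rw [h2]
          have := hZ.pres _ hEK i s t
          linarith
      have l := zrho_ge T hZ.pres ρ hρ (zE e) 4 (by norm_num) i0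
        (by rw [zqf_E, he0]; norm_num) (fun i s t => by
          have a1 := hs i s t
          have a2 := hZ.pres _ hs i s t
          simp only [map_sub, map_smul, Pi.sub_apply, zqf_sub, Pi.smul_apply, zqf_smul] at a1 a2 ⊢
          linarith)
      refine lt_of_lt_of_le ?_ l
      rw [Real.lt_sqrt (by norm_num)]; norm_num
    · push Not at h1
      let W0 : Fin d → Sym2Mat := fun i => zX (η * lam i) β (e i)
      have hWz : ∀ j, j ≠ i0 → ∀ s t, zqf (W0 j) s t = 0 := fun j hj s t => by
        simp [W0, e, hj, zX, zqf_mk]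
      have hl1 : ∀ i, η * lam i < 1 := fun i => (hle i).trans_lt h1
      have hWK : ZK W0 := fun i s t => by
        refine le_trans ?_ (zqf_X_lower _ _ _ _ _ hβ0 (ha i) (hl1 i) (he i))
        have h1 : η * lam i / (1 + β) < 1 := by
          rw [div_lt_one (by positivity)]; linarith [hl1 i]
        have h2 : 0 < 1 - η * lam i / (1 + β) := by linarith
        have h3 := he i; have h4 := ha i
        positivity
      refine zsuper hZ hβ0 hβ1 ha ρ hρ e he (fun i _ => hl1 i) W0 (2 * ‖W0‖ + 1)
        ((η * lam i0) ^ 2) (by positivity) (by have := ha i0; positivity) ?_ i0 ?_ ?_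
      · intro i s t
        by_cases hi : i = i0
        · rw [hi]
          rw [he0, one_mul]
          refine (le_abs_self _).trans ((zqf_abs_le _ _ _).trans ?_)
          have := norm_le_pi_norm W0 i0
          gcongr; linarith
        · rw [hWz i hi]; simp [e, hi]
      · simp only [W0, zqf_X_one, he0]; norm_num
      · intro i s t
        simp only [Pi.sub_apply, zqf_sub, Pi.smul_apply, zqf_smul]
        by_cases hi : i = i0
        · rw [hi]
          rw [hZ, hsum W0 (fun j hj => hWz j hj 1 0), zqf_E]
          simp only [W0, zqf_X_step _ _ _ _ _ hβ0, zqf_X_one, he0]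
          have hA := ha i0
          generalize η * lam i0 = a at *
          have k : 0 ≤ a ^ 2 - (2 * a * (1 - β) - a ^ 2 * (1 - β) / (1 + β)) := by
            have : a ^ 2 - (2 * a * (1 - β) - a ^ 2 * (1 - β) / (1 + β))
                = 2 * a * (a - (1 - β ^ 2)) / (1 + β) := by
              have h3 : 1 + β ≠ 0 := by positivity
              field_simp
              ring
            rw [this]
            have := sub_nonneg.2 hcrit
            positivity
          have := mul_nonneg k (sq_nonneg (s - t))
          linarith
        · rw [hWz i hi, zqf_E]
          have := hZ.pres _ hWK i s t
          simp only [e, hi]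
          simp only [if_false]
          linarith
end
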